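/- Let L be a simple graph on a finite vertex set V with |V| = N whose maximal degree is at most M, and let j ≥ 1 be an integer. Then the number of j-tuples (v_1, …, v_j) ∈ V^j (vertices not necessarily distinct) such that the subgraph of L induced on the set {v_1, …, v_j} is connected is at most j! · (j-1)! · N · (M+1)^{j-1}. -/

import Mathlib

/-- A tuple of length at least two with connected induced subgraph has an entry whose removal
leaves a tuple with connected induced subgraph, and which equals or is adjacent to one of the
remaining entries. -/
lemma SimpleGraph.exists_removeNth_connected_induce_range {V : Type*} (L : SimpleGraph V)
    {n : ℕ} (t : Fin (n + 2) → V) (ht : (L.induce (Set.range t)).Connected) :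
    ∃ (i : Fin (n + 2)) (k : Fin (n + 1)),
      (L.induce (Set.range (i.removeNth t))).Connected ∧
        (t i = i.removeNth t k ∨ L.Adj (i.removeNth t k) (t i)) := by
  by_cases hinj : Function.Injective t
  · have : Nontrivial (Set.range t) :=
      (Equiv.ofInjective t hinj).injective.nontrivial
    obtain ⟨⟨_, i, rfl⟩, hx⟩ := ht.exists_connected_induce_compl_singleton_of_finite_nontrivial
    obtain ⟨⟨_, a, rfl⟩, ha⟩ := ht.preconnected.exists_adj_of_nontrivial ⟨t i, i, rfl⟩
    have hadj : L.Adj (t i) (t a) := ha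
    have hai : a ≠ i := fun h => hadj.ne (by rw [h])
    obtain ⟨k, rfl⟩ := Fin.exists_succAbove_eq hai
    refine ⟨i, k, ?_, Or.inr hadj.symm⟩
    let f : (L.induce (Set.range t)).induce {⟨t i, i, rfl⟩}ᶜ →g
        L.induce (Set.range (i.removeNth t)) :=
      { toFun := fun y => ⟨y.1.1, by
          obtain ⟨⟨_, b, rfl⟩, hb⟩ := y
          have hbi : b ≠ i := by
            rintro rfl
            exact hb rfl
          obtain ⟨c, rfl⟩ := Fin.exists_succAbove_eq hbi
          exact ⟨c, rfl⟩⟩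
        map_rel' := fun h => h }
    refine hx.map f ?_
    rintro ⟨_, c, rfl⟩
    refine ⟨⟨⟨t (i.succAbove c), _, rfl⟩, fun h => ?_⟩, rfl⟩
    exact Fin.succAbove_ne i c (hinj (congrArg Subtype.val h))
  · obtain ⟨i, a, hia, hne⟩ := Function.not_injective_iff.mp hinj
    obtain ⟨k, rfl⟩ := Fin.exists_succAbove_eq hne.symm
    refine ⟨i, k, ?_, Or.inl hia⟩
    have hmem : t i ∈ Set.range (i.removeNth t) := ⟨k, hia.symm⟩
    have hrange : Set.range (i.removeNth t) = Set.range t := by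
      conv_rhs => rw [← Fin.insertNth_self_removeNth i t, Fin.range_insertNth]
      exact (Set.insert_eq_of_mem hmem).symm
    rwa [hrange]

open Classical in
/-- Lengthening the tuples by one multiplies the number of those with connected induced subgraph
by at most `(n + 2) (n + 1) (M + 1)`. -/
lemma SimpleGraph.card_connected_induce_range_succ_le {V : Type*} [Fintype V]
    (L : SimpleGraph V) [DecidableRel L.Adj] (M : ℕ) (hM : L.maxDegree ≤ M) (n : ℕ) :
    Nat.card {t : Fin (n + 2) → V // (L.induce (Set.range t)).Connected} ≤
      (n + 2) * (n + 1) * (M + 1) *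
        Nat.card {t : Fin (n + 1) → V // (L.induce (Set.range t)).Connected} := by
  simp only [Nat.card_eq_fintype_card, Fintype.card_subtype]
  set S : Finset (Fin (n + 1) → V) := {t | (L.induce (Set.range t)).Connected}
  let extensions (p : Fin (n + 2) × Fin (n + 1) × (Fin (n + 1) → V)) : Finset (Fin (n + 2) → V) :=
    (insert (p.2.2 p.2.1) (L.neighborFinset (p.2.2 p.2.1))).image
      fun v => p.1.insertNth v p.2.2
  have hcard : ∀ p ∈ Finset.univ ×ˢ Finset.univ ×ˢ S, (extensions p).card ≤ M + 1 := fun p _ =>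
    Finset.card_image_le.trans <| (Finset.card_insert_le _ _).trans <|
      Nat.succ_le_succ <| (L.card_neighborFinset_eq_degree _).trans_le <|
        (L.degree_le_maxDegree _).trans hM
  calc
    _ ≤ ((Finset.univ ×ˢ Finset.univ ×ˢ S).biUnion extensions).card := by
      refine Finset.card_le_card fun t ht => ?_
      obtain ⟨i, k, hconn, hik⟩ :=
        L.exists_removeNth_connected_induce_range t (Finset.mem_filter.mp ht).2
      refine Finset.mem_biUnion.mpr ⟨(i, k, i.removeNth t), by simpa [S] using hconn, ?_⟩
      refine Finset.mem_image.mpr ⟨t i, ?_, Fin.insertNth_self_removeNth i t⟩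
      simpa only [Finset.mem_insert, L.mem_neighborFinset] using hik
    _ ≤ (Finset.univ ×ˢ Finset.univ ×ˢ S).card * (M + 1) :=
      Finset.card_biUnion_le_card_mul _ _ _ hcard
    _ = (n + 2) * (n + 1) * (M + 1) * S.card := by
      simp only [Finset.card_product, Finset.card_univ, Fintype.card_fin]
      ring

/-- **Counting connected tuples in a bounded-degree graph**: in a graph on `N`
vertices of maximal degree at most `M`, the number of `j`-tuples of (not necessarily
distinct) vertices whose induced subgraph is connected is at most
`j! (j-1)! N (M+1)^{j-1}`. -/
theorem count_connected_tuples_le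
    {V : Type*} [Fintype V] (L : SimpleGraph V) [DecidableRel L.Adj]
    (M : ℕ) (hM : L.maxDegree ≤ M) (j : ℕ) (hj : 1 ≤ j) :
    Nat.card {t : Fin j → V // (L.induce (Set.range t)).Connected} ≤
      j.factorial * (j - 1).factorial * Fintype.card V * (M + 1) ^ (j - 1) := by
  obtain ⟨n, rfl⟩ := Nat.exists_eq_add_of_le' hj
  clear hj
  induction n with
  | zero =>
    refine (Nat.card_le_card_of_injective _ Subtype.val_injective).trans ?_
    simp
  | succ n ih =>
    refine (L.card_connected_induce_range_succ_le M hM n).trans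
      ((Nat.mul_le_mul_left _ ih).trans_eq ?_)
    simp only [Nat.add_sub_cancel, Nat.factorial_succ, pow_succ]
    ring
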